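/- arXiv:2009.10881 — 2 statements merged into one kernel-verified Lean document; each statement's English description precedes it below -/
import Mathlib

section
/- Let L be a complete lattice, A a type, F : (A → L) → (A → L) a monotone function with respect to the pointwise order on A → L, and S ⊆ A a set that is dependency-closed for F, i.e. for all g, h : A → L that agree on S, the functions F(g) and F(h) agree on S. Define the localised operator F_S : (S → L) → (S → L) by F_S(h)(a) = F(ĥ)(a) for a ∈ S, where ĥ : A → L extends h by the value ⊥ outside S. Then F_S is monotone, and the least fixed point of F agrees with the least fixed point of F_S on S: for every a ∈ S, (lfp F)(a) = (lfp F_S)(a). -/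
open Classical

/-- Correctness of local least-fixpoint iteration: if `S` is dependency-closed
for the monotone functional `F`, then the localised operator `F_S` (extending
arguments by `⊥` outside `S`) is monotone, and the least fixed point of `F`
agrees with the least fixed point of `F_S` on `S`. -/

theorem stmt_15 {L A : Type*} [CompleteLattice L]
    (F : (A → L) → (A → L)) (hF : Monotone F) (S : Set A)
    (hS : ∀ g h : A → L, (∀ a ∈ S, g a = h a) → ∀ a ∈ S, F g a = F h a) :
    ∃ hmono : Monotone (fun h : S → L => fun a : S =>
        F (fun x : A => if hx : x ∈ S then h ⟨x, hx⟩ else ⊥) a),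
      ∀ a : S, OrderHom.lfp ⟨F, hF⟩ (a : A) =
        OrderHom.lfp (⟨fun h : S → L => fun a : S =>
          F (fun x : A => if hx : x ∈ S then h ⟨x, hx⟩ else ⊥) a, hmono⟩ : (S → L) →o (S → L)) a := by
  have hmono : Monotone (fun h : S → L => fun a : S =>
      F (fun x : A => if hx : x ∈ S then h ⟨x, hx⟩ else ⊥) a) := by
    intro h k hk a
    refine hF (fun x => ?_) a
    by_cases hx : x ∈ S
    · simpa [hx] using hk ⟨x, hx⟩
    · simp [hx]
  refine ⟨hmono, fun a => le_antisymm ?_ ?_⟩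
  · let FS : (S → L) →o (S → L) := ⟨_, hmono⟩
    let g : A → L := fun x => if hx : x ∈ S then FS.lfp ⟨x, hx⟩ else ⊤
    have hg : F g ≤ g := by
      intro x
      by_cases hx : x ∈ S
      · have agree := hS g (fun x => if hx : x ∈ S then FS.lfp ⟨x, hx⟩ else ⊥)
          (fun y hy => by simp [g, hy]) x hx
        have fixed : F (fun x => if hx : x ∈ S then FS.lfp ⟨x, hx⟩ else ⊥) x =
            FS.lfp ⟨x, hx⟩ := congrFun FS.map_lfp ⟨x, hx⟩
        rw [agree, fixed]
        simp [g, hx]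
      · simp [g, hx]
    have hle := OrderHom.lfp_le ⟨F, hF⟩ hg (a : A)
    simpa [g] using hle
  · refine OrderHom.lfp_le _ (a := fun x : S => OrderHom.lfp ⟨F, hF⟩ (x : A)) (fun x => ?_) a
    have agree := hS (fun y => if y ∈ S then OrderHom.lfp ⟨F, hF⟩ y else ⊥)
      (OrderHom.lfp ⟨F, hF⟩) (fun y hy => by simp [hy]) x x.2
    exact (agree.trans (congrFun (OrderHom.map_lfp ⟨F, hF⟩) (x : A))).le
end

section
/- Let L be a complete lattice, A a type, F : (A → L) → (A → L) a monotone function with respect to the pointwise order on A → L, and S ⊆ A a set that is dependency-closed for F, i.e. for all g, h : A → L that agree on S, the functions F(g) and F(h) agree on S. Define the localised operator F_S : (S → L) → (S → L) by F_S(h)(a) = F(ĥ)(a) for a ∈ S, where ĥ : A → L extends h by the value ⊤ outside S. Then F_S is monotone, and the greatest fixed point of F agrees with the greatest fixed point of F_S on S: for every a ∈ S, (gfp F)(a) = (gfp F_S)(a). -/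
open Classical

/-- Correctness of local greatest-fixpoint iteration: if `S` is
dependency-closed for the monotone functional `F`, then the localised operator
`F_S` (extending arguments by `⊤` outside `S`) is monotone, and the greatest
fixed point of `F` agrees with the greatest fixed point of `F_S` on `S`. -/

theorem stmt_16 {L A : Type*} [CompleteLattice L]
    (F : (A → L) → (A → L)) (hF : Monotone F) (S : Set A)
    (hS : ∀ g h : A → L, (∀ a ∈ S, g a = h a) → ∀ a ∈ S, F g a = F h a) :
    ∃ hmono : Monotone (fun h : S → L => fun a : S =>
        F (fun x : A => if hx : x ∈ S then h ⟨x, hx⟩ else ⊤) a),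
      ∀ a : S, OrderHom.gfp ⟨F, hF⟩ (a : A) =
        OrderHom.gfp (⟨fun h : S → L => fun a : S =>
          F (fun x : A => if hx : x ∈ S then h ⟨x, hx⟩ else ⊤) a, hmono⟩ : (S → L) →o (S → L)) a := by
  have hmono : Monotone (fun h : S → L => fun a : S =>
      F (fun x : A => if hx : x ∈ S then h ⟨x, hx⟩ else ⊤) a) := by
    intro h k hhk a
    refine hF (fun x => ?_) a
    by_cases hx : x ∈ S
    · simpa [hx] using hhk ⟨x, hx⟩
    · simp [hx]
  refine ⟨hmono, fun a => le_antisymm ?_ ?_⟩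
  · have hfix : F (OrderHom.gfp ⟨F, hF⟩) = OrderHom.gfp ⟨F, hF⟩ := OrderHom.map_gfp ⟨F, hF⟩
    refine OrderHom.le_gfp (⟨_, hmono⟩ : (S → L) →o (S → L))
      (a := fun b : S => OrderHom.gfp ⟨F, hF⟩ (b : A)) (fun b => ?_) a
    refine (congrFun hfix (b : A)).symm.trans (hS _ _ (fun x hx => ?_) b b.2) |>.le
    simp [hx]
  · set u := OrderHom.gfp (⟨_, hmono⟩ : (S → L) →o (S → L))
    have hfix : (fun b : S => F (fun x : A => if hx : x ∈ S then u ⟨x, hx⟩ else ⊤) b) = u :=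
      OrderHom.map_gfp (⟨_, hmono⟩ : (S → L) →o (S → L))
    have hle : (fun x : A => if hx : x ∈ S then u ⟨x, hx⟩ else ⊥) ≤ OrderHom.gfp ⟨F, hF⟩ := by
      refine OrderHom.le_gfp ⟨F, hF⟩ (fun x => ?_)
      by_cases hx : x ∈ S
      · simp only [hx, dite_true]
        refine (congrFun hfix ⟨x, hx⟩).symm.trans (hS _ _ (fun y hy => ?_) x hx) |>.le
        simp [hy]
      · simp [hx]
    simpa using hle a
end
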